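/- arXiv:1003.1652 — 3 statements merged into one kernel-verified Lean document; each statement's English description precedes it below -/
import Mathlib

section
/- For every θ with 0 < θ < π and every t > 0, one has ∫_{-∞}^{∞} (e^{-2rθ}/(1 + e^{-2πr})) · e^{-t r²} dr ≤ 1/(2θ) + 1/(2(π − θ)). -/
open MeasureTheory Real

theorem elliptic_integrand_le_exp (θ t r : ℝ) (ht : 0 < t) :
    exp (-(2 * r * θ)) / (1 + exp (-(2 * π * r))) * exp (-(t * r ^ 2)) ≤ exp (-(2 * θ) * r) := by
  have h1 : exp (-(t * r ^ 2)) ≤ 1 := exp_le_one_iff.2 (by nlinarith [mul_nonneg ht.le (sq_nonneg r)])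
  have h2 : exp (-(2 * r * θ)) / (1 + exp (-(2 * π * r))) ≤ exp (-(2 * r * θ)) :=
    div_le_self (exp_pos _).le (by linarith [exp_pos (-(2 * π * r))])
  calc _ ≤ exp (-(2 * r * θ)) / (1 + exp (-(2 * π * r))) :=
        mul_le_of_le_one_right (by positivity) h1
    _ ≤ exp (-(2 * r * θ)) := h2
    _ = _ := by ring_nf

/-- The reflection `r ↦ -r` exchanges `θ` and `π - θ`. -/
theorem elliptic_integrand_reflect (θ t r : ℝ) :
    exp (-(2 * r * θ)) / (1 + exp (-(2 * π * r))) * exp (-(t * r ^ 2)) =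
      exp (-(2 * (-r) * (π - θ))) / (1 + exp (-(2 * π * (-r)))) * exp (-(t * (-r) ^ 2)) := by
  rw [neg_sq, mul_eq_mul_right_iff, div_eq_div_iff (by positivity) (by positivity)]
  left
  simp only [mul_add, mul_one, ← exp_add]
  ring_nf

/-- Bound for the elliptic-term integral in the Selberg trace formula:
for `0 < θ < π` and `t > 0`,
`∫ℝ (e^{-2rθ}/(1+e^{-2πr})) e^{-t r²} dr ≤ 1/(2θ) + 1/(2(π-θ))`. -/
theorem elliptic_term_integral_bound (θ t : ℝ) (hθ0 : 0 < θ) (hθπ : θ < Real.pi)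
    (ht : 0 < t) :
    (∫ r : ℝ, Real.exp (-(2 * r * θ)) / (1 + Real.exp (-(2 * Real.pi * r)))
        * Real.exp (-(t * r ^ 2)))
      ≤ 1 / (2 * θ) + 1 / (2 * (Real.pi - θ)) := by
  set f : ℝ → ℝ := fun r ↦ exp (-(2 * r * θ)) / (1 + exp (-(2 * π * r))) * exp (-(t * r ^ 2))
    with hf
  have hf0 (r : ℝ) : 0 ≤ f r := by positivity
  have hfm : AEStronglyMeasurable f volume := by
    have : Measurable f := by fun_prop
    exact this.aestronglyMeasurable
  have hle (r : ℝ) : f r ≤ exp (-(2 * θ) * r) := elliptic_integrand_le_exp θ t r ht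
  have hle' (r : ℝ) : f r ≤ exp (2 * (π - θ) * r) := by
    rw [hf]
    dsimp only
    rw [elliptic_integrand_reflect]
    exact (elliptic_integrand_le_exp (π - θ) t (-r) ht).trans_eq (by ring_nf)
  have hneg : -(2 * θ) < 0 := by linarith
  have hpos : 0 < 2 * (π - θ) := by linarith
  have hI := integrableOn_exp_mul_Ioi hneg 0
  have hI' := integrableOn_exp_mul_Iic hpos 0
  have hfI : IntegrableOn f (Set.Ioi 0) := hI.mono' hfm.restrict
    (.of_forall fun r ↦ by simpa [abs_of_nonneg (hf0 r)] using hle r)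
  have hfI' : IntegrableOn f (Set.Iic 0) := hI'.mono' hfm.restrict
    (.of_forall fun r ↦ by simpa [abs_of_nonneg (hf0 r)] using hle' r)
  have hb := setIntegral_mono hfI hI hle
  have hb' := setIntegral_mono hfI' hI' hle'
  rw [integral_exp_mul_Ioi hneg] at hb
  rw [integral_exp_mul_Iic hpos] at hb'
  rw [← intervalIntegral.integral_Iic_add_Ioi hfI' hfI, add_comm]
  simp only [mul_zero, exp_zero, neg_div_neg_eq] at hb hb'
  exact add_le_add hb hb'
end

section
/- For every t > 0, one has (1/(2t)) · (1/√(4πt)) · ∫_{1}^{∞} (log x) · e^{-(log x)²/(4t)} dx ≤ e^{t} + 1/√(4πt). -/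
open MeasureTheory Real Set

/-- Completing the square in the exponent `u - u² / (4t)`. -/
lemma exp_sub_sq_div_eq (t : ℝ) (ht : 0 < t) (u : ℝ) :
    exp (u - u ^ 2 / (4 * t)) = exp t * exp (-(1 / (4 * t)) * (u - 2 * t) ^ 2) := by
  rw [← exp_add]
  congr 1
  field_simp
  ring

lemma integrable_exp_sub_sq_div (t : ℝ) (ht : 0 < t) :
    Integrable fun u : ℝ => exp (u - u ^ 2 / (4 * t)) := by
  simp_rw [exp_sub_sq_div_eq t ht]
  exact ((integrable_exp_neg_mul_sq (b := 1 / (4 * t)) (by positivity)).comp_sub_right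
    (2 * t)).const_mul _

lemma integral_exp_sub_sq_div (t : ℝ) (ht : 0 < t) :
    ∫ u : ℝ, exp (u - u ^ 2 / (4 * t)) = exp t * √(4 * π * t) := by
  simp_rw [exp_sub_sq_div_eq t ht]
  rw [integral_const_mul,
    integral_sub_right_eq_self (fun u : ℝ => exp (-(1 / (4 * t)) * u ^ 2)) (2 * t),
    integral_gaussian]
  congr 2
  field_simp

lemma integrable_sub_mul_exp_sub_sq_div (t : ℝ) (ht : 0 < t) :
    Integrable fun u : ℝ => (u - 2 * t) * exp (u - u ^ 2 / (4 * t)) := by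
  simp_rw [exp_sub_sq_div_eq t ht, mul_left_comm _ (exp t)]
  exact ((integrable_mul_exp_neg_mul_sq (b := 1 / (4 * t)) (by positivity)).comp_sub_right
    (2 * t)).const_mul _

lemma integral_Ioi_sub_mul_exp_sub_sq_div (t : ℝ) (ht : 0 < t) :
    ∫ u in Ioi (0 : ℝ), (u - 2 * t) * exp (u - u ^ 2 / (4 * t)) = 2 * t := by
  have hderiv : ∀ u : ℝ, HasDerivAt (fun u : ℝ => -(2 * t) * exp (u - u ^ 2 / (4 * t)))
      ((u - 2 * t) * exp (u - u ^ 2 / (4 * t))) u := by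
    intro u
    refine ((((hasDerivAt_id' u).sub ((hasDerivAt_pow 2 u).div_const (4 * t))).exp).const_mul
      (-(2 * t))).congr_deriv ?_
    simp only [Pi.sub_apply, Nat.cast_ofNat]
    field_simp
    ring
  have hint := (integrable_sub_mul_exp_sub_sq_div t ht).integrableOn (s := Ioi 0)
  rw [integral_Ioi_of_hasDerivAt_of_tendsto' (fun u _ => hderiv u) hint
    (tendsto_zero_of_hasDerivAt_of_integrableOn_Ioi (fun u _ => hderiv u) hint
      ((integrable_exp_sub_sq_div t ht).const_mul _).integrableOn)]
  simp

lemma integral_Ici_one_log_mul_exp (t : ℝ) :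
    ∫ x in Ici (1 : ℝ), log x * exp (-(log x) ^ 2 / (4 * t)) =
      ∫ u in Ioi (0 : ℝ), u * exp (u - u ^ 2 / (4 * t)) := by
  have himage : exp '' Ioi 0 = Ioi 1 := by
    ext x
    constructor
    · rintro ⟨u, hu, rfl⟩
      exact one_lt_exp_iff.2 hu
    · intro hx
      exact ⟨log x, log_pos hx, exp_log (zero_lt_one.trans hx)⟩
  rw [integral_Ici_eq_integral_Ioi, ← himage,
    integral_image_eq_integral_abs_deriv_smul measurableSet_Ioi
      (fun u _ => (hasDerivAt_exp u).hasDerivWithinAt) exp_injective.injOn]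
  congr 1 with u
  rw [abs_exp, log_exp, smul_eq_mul, mul_left_comm, ← exp_add]
  ring_nf

/-- The substantive estimate for the hyperbolic term: for every `t > 0`,
`(1/(2t)) (1/√(4πt)) ∫_{1}^{∞} (log x) e^{-(log x)²/(4t)} dx ≤ e^t + 1/√(4πt)`. -/
theorem hyperbolic_term_integral_bound (t : ℝ) (ht : 0 < t) :
    (1 / (2 * t)) * (1 / Real.sqrt (4 * Real.pi * t)) *
        ∫ x in Ici (1 : ℝ), Real.log x * Real.exp (-(Real.log x) ^ 2 / (4 * t))
      ≤ Real.exp t + 1 / Real.sqrt (4 * Real.pi * t) := by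
  have hsplit : ∫ u in Ioi (0 : ℝ), u * exp (u - u ^ 2 / (4 * t)) =
      2 * t + 2 * t * ∫ u in Ioi (0 : ℝ), exp (u - u ^ 2 / (4 * t)) := by
    rw [← integral_const_mul]
    conv_rhs => enter [1]; rw [← integral_Ioi_sub_mul_exp_sub_sq_div t ht]
    rw [← integral_add (integrable_sub_mul_exp_sub_sq_div t ht).integrableOn
      ((integrable_exp_sub_sq_div t ht).const_mul _).integrableOn]
    congr 1 with u
    ring
  have hle : ∫ u in Ioi (0 : ℝ), exp (u - u ^ 2 / (4 * t)) ≤ exp t * √(4 * π * t) := by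
    rw [← integral_exp_sub_sq_div t ht]
    exact setIntegral_le_integral (integrable_exp_sub_sq_div t ht)
      (.of_forall fun u => (exp_pos _).le)
  have hsqrt : 0 < √(4 * π * t) := by positivity
  rw [integral_Ici_one_log_mul_exp, hsplit]
  calc _ ≤ 1 / (2 * t) * (1 / √(4 * π * t)) * (2 * t + 2 * t * (exp t * √(4 * π * t))) := by
        gcongr
    _ = _ := by
        field_simp
        ring
end

section
/- Let c and x be real numbers with 1 < c ≤ x, and let s ∈ [1/2, 1]. Then |∫_{c}^{x} (y^{s−1}/log y) dy − ∫_{2}^{x^{s}} (1/log t) dt| ≤ |c − 2|·(1/log 2) + |2 − √c|·(2/log c). -/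
open intervalIntegral Real

theorem intervalIntegrable_one_div_log {a b : ℝ} (ha : 1 < a) (hb : 1 < b) :
    IntervalIntegrable (fun t : ℝ => 1 / Real.log t) MeasureTheory.volume a b := by
  refine ContinuousOn.intervalIntegrable fun t ht => ?_
  have h1 : 1 < t := lt_of_lt_of_le (lt_min ha hb) ht.1
  exact (continuousAt_const.div (Real.continuousAt_log (by linarith))
    (Real.log_pos h1).ne').continuousWithinAt

/-- The substitution `t = y ^ s` in the logarithmic integral. -/
theorem integral_rpow_div_log_eq {c x s : ℝ} (hc : 1 < c) (hx : 1 < x) (hs : 0 < s) :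
    ∫ y in c..x, y ^ (s - 1) / Real.log y = ∫ t in (c ^ s)..(x ^ s), 1 / Real.log t := by
  have h1 : ∀ y ∈ Set.uIcc c x, 1 < y := fun y hy => lt_of_lt_of_le (lt_min hc hx) hy.1
  rw [← integral_comp_mul_deriv' (f := fun y : ℝ => y ^ s) (f' := fun y => s * y ^ (s - 1))
    (g := fun t => 1 / Real.log t)]
  · refine integral_congr fun y hy => ?_
    have hy1 := h1 y hy
    have hl := (Real.log_pos hy1).ne'
    simp only [Function.comp_apply, Real.log_rpow (by linarith : 0 < y)]
    field_simp
  · intro y hy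
    exact Real.hasDerivAt_rpow_const (Or.inl (by linarith [h1 y hy]))
  · intro y hy
    exact (continuousAt_const.mul (Real.continuousAt_rpow_const _ _
      (Or.inl (by linarith [h1 y hy])))).continuousWithinAt
  · rintro _ ⟨y, hy, rfl⟩
    have h2 : 1 < y ^ s := Real.one_lt_rpow (h1 y hy) hs
    exact (continuousAt_const.div (Real.continuousAt_log (by linarith))
      (Real.log_pos h2).ne').continuousWithinAt

theorem abs_integral_one_div_log_le {a b : ℝ} (ha : 1 < a) (hab : a ≤ b) :
    |∫ t in a..b, 1 / Real.log t| ≤ (b - a) * (1 / Real.log a) := by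
  have h := norm_integral_le_of_norm_le_const (a := a) (b := b)
    (f := fun t => 1 / Real.log t) (C := 1 / Real.log a) (fun t ht => by
      rw [Set.uIoc_of_le hab] at ht
      have hl := Real.log_pos ha
      have hlt : Real.log a ≤ Real.log t := Real.log_le_log (by linarith) ht.1.le
      rw [Real.norm_of_nonneg (one_div_nonneg.2 (hl.le.trans hlt))]
      exact one_div_le_one_div_of_le hl hlt)
  rwa [Real.norm_eq_abs, abs_of_nonneg (sub_nonneg.2 hab), mul_comm] at h

/-- The paper's Lemma 5.12: for `1 < c ≤ x` and `s ∈ [1/2, 1]`,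
`|∫_c^x y^{s-1}/log y dy − li(x^s)| ≤ |c−2|/log 2 + |2−√c|·2/log c`,
where `li(a) = ∫_2^a dt/log t` (oriented integral). -/
theorem int_rpow_div_log_sub_li_bound (c x s : ℝ) (hc : 1 < c) (hcx : c ≤ x)
    (hs : s ∈ Set.Icc (1 / 2 : ℝ) 1) :
    |(∫ y in c..x, y ^ (s - 1) / Real.log y) - ∫ t in (2 : ℝ)..(x ^ s), 1 / Real.log t|
      ≤ |c - 2| * (1 / Real.log 2) + |2 - Real.sqrt c| * (2 / Real.log c) := by
  obtain ⟨hs1, hs2⟩ := hs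
  have hs0 : 0 < s := by linarith
  have hcs : 1 < c ^ s := Real.one_lt_rpow hc hs0
  have hxs : 1 < x ^ s := Real.one_lt_rpow (hc.trans_le hcx) hs0
  have hlc := Real.log_pos hc
  have hl2 : 0 < Real.log 2 := Real.log_pos one_lt_two
  have hle : c ^ s ≤ c := by
    simpa using Real.rpow_le_rpow_of_exponent_le hc.le hs2
  have hsqrt : Real.sqrt c ≤ c ^ s := by
    rw [Real.sqrt_eq_rpow]
    exact Real.rpow_le_rpow_of_exponent_le hc.le hs1
  rw [integral_rpow_div_log_eq hc (hc.trans_le hcx) hs0,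
    ← integral_add_adjacent_intervals (intervalIntegrable_one_div_log hcs one_lt_two)
      (intervalIntegrable_one_div_log one_lt_two hxs), add_sub_cancel_right]
  have hA : 0 ≤ |c - 2| * (1 / Real.log 2) := by positivity
  have hB : 0 ≤ |2 - Real.sqrt c| * (2 / Real.log c) := by positivity
  rcases le_total 2 (c ^ s) with h | h
  · rw [integral_symm, abs_neg]
    have h1 := abs_integral_one_div_log_le one_lt_two h
    have h2 : (c ^ s - 2) * (1 / Real.log 2) ≤ |c - 2| * (1 / Real.log 2) := by
      gcongr
      exact le_trans (by linarith) (le_abs_self _)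
    linarith
  · have h1 := abs_integral_one_div_log_le hcs h
    have h2 : (2 - c ^ s) * (1 / Real.log (c ^ s)) ≤
        |2 - Real.sqrt c| * (2 / Real.log c) := by
      apply mul_le_mul _ _ (one_div_nonneg.2 (Real.log_pos hcs).le) (abs_nonneg _)
      · exact le_trans (by linarith) (le_abs_self _)
      · rw [Real.log_rpow (by linarith), div_le_div_iff₀ (by positivity) hlc]
        nlinarith
    linarith
end
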